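/- Let δ^1,...,δ^H, δ'^1,...,δ'^H be 2H vectors in S_n, let γ > 0, and suppose δ'^h ⪯_γ δ^h for every h ∈ [H], i.e., top-ℓ-bar(δ'^h) ≤ γ·top-ℓ-bar(δ^h) for every real ℓ ∈ [0,n]. Let β_1,...,β_H ∈ [0,1] with ∑_h β_h = 1. Then ∑_h β_h δ'^h ⪯_γ ∑_h β_h δ^h. -/

import Mathlib

/-- Membership in `S_n`: a finitely supported non-negative vector indexed by `ℕ`
whose coordinates sum to `n`. -/
def memS (n : ℕ) (δ : ℕ → ℝ) : Prop :=
  (∀ a, 0 ≤ δ a) ∧ (Function.support δ).Finite ∧ (∑' a, δ a) = n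

/-- `topBar δ ℓ` is the optimal value of the LP:
maximize `∑_a a·α_a` subject to `0 ≤ α ≤ δ` and `∑_a α_a = ℓ`. -/
noncomputable def topBar (δ : ℕ → ℝ) (ℓ : ℝ) : ℝ :=
  sSup {s : ℝ | ∃ α : ℕ → ℝ, (∀ a, 0 ≤ α a ∧ α a ≤ δ a) ∧ (∑' a, α a) = ℓ ∧
    s = ∑' a : ℕ, (a : ℝ) * α a}

/-- `δ' ⪯_γ δ`: `topBar δ' ℓ ≤ γ · topBar δ ℓ` for every real `ℓ ∈ [0,n]`. -/
def Dominates (n : ℕ) (γ : ℝ) (δ' δ : ℕ → ℝ) : Prop :=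
  ∀ ℓ : ℝ, 0 ≤ ℓ → ℓ ≤ n → topBar δ' ℓ ≤ γ * topBar δ ℓ

theorem aux_le_topBar (N : ℕ) (δ : ℕ → ℝ) (hN : ∀ a, N ≤ a → δ a = 0) (α : ℕ → ℝ)
    (hα : ∀ a, 0 ≤ α a ∧ α a ≤ δ a) :
    (∑ a ∈ Finset.range N, (a : ℝ) * α a) ≤ topBar δ (∑ a ∈ Finset.range N, α a) := by
  have hz : ∀ α : ℕ → ℝ, (∀ a, 0 ≤ α a ∧ α a ≤ δ a) → ∀ a, a ∉ Finset.range N → α a = 0 := by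
    intro α hα a ha
    have h1 := hN a (by simpa using ha)
    have h2 := hα a
    linarith
  apply le_csSup
  · refine ⟨∑ a ∈ Finset.range N, (a : ℝ) * δ a, ?_⟩
    rintro s ⟨α, hα, -, rfl⟩
    rw [tsum_eq_sum (s := Finset.range N) (fun a ha => by rw [hz α hα a ha, mul_zero])]
    exact Finset.sum_le_sum fun a _ => mul_le_mul_of_nonneg_left (hα a).2 (Nat.cast_nonneg a)
  · refine ⟨α, hα, ?_, ?_⟩
    · exact tsum_eq_sum (hz α hα)
    · rw [tsum_eq_sum (s := Finset.range N) (fun a ha => by rw [hz α hα a ha, mul_zero])]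

theorem aux_near (n N : ℕ) (δ : ℕ → ℝ) (hN : ∀ a, N ≤ a → δ a = 0) (h0 : ∀ a, 0 ≤ δ a)
    (hs : ∑ a ∈ Finset.range N, δ a = n) (l : ℝ) (hl0 : 0 ≤ l) (hln : l ≤ n)
    (ε : ℝ) (hε : 0 < ε) :
    ∃ α : ℕ → ℝ, (∀ a, 0 ≤ α a ∧ α a ≤ δ a) ∧ (∑ a ∈ Finset.range N, α a) = l ∧
      topBar δ l - ε < ∑ a ∈ Finset.range N, (a : ℝ) * α a := by
  have hz : ∀ α : ℕ → ℝ, (∀ a, 0 ≤ α a ∧ α a ≤ δ a) → ∀ a, a ∉ Finset.range N → α a = 0 := by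
    intro α hα a ha
    have h1 := hN a (by simpa using ha)
    have h2 := hα a
    linarith
  have hne : {s : ℝ | ∃ α : ℕ → ℝ, (∀ a, 0 ≤ α a ∧ α a ≤ δ a) ∧ (∑' a, α a) = l ∧
    s = ∑' a : ℕ, (a : ℝ) * α a}.Nonempty := by
    have hb : ∀ a, 0 ≤ l / n * δ a ∧ l / n * δ a ≤ δ a := by
      intro a
      have h1 : 0 ≤ l / n := by positivity
      have h2 : l / n ≤ 1 := div_le_one_of_le₀ hln (by positivity)
      exact ⟨mul_nonneg h1 (h0 a), mul_le_of_le_one_left (h0 a) h2⟩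
    refine ⟨_, fun a => l / n * δ a, hb, ?_, rfl⟩
    rw [tsum_eq_sum (hz _ hb), ← Finset.mul_sum, hs]
    rcases eq_or_ne (n : ℝ) 0 with h | h
    · rw [h] at hln ⊢
      simp
      linarith
    · field_simp
  obtain ⟨s, ⟨α, hα, h1, rfl⟩, h2⟩ := exists_lt_of_lt_csSup hne
    (show topBar δ l - ε < sSup _ from sub_lt_self _ hε)
  refine ⟨α, hα, ?_, ?_⟩
  · rw [← h1, tsum_eq_sum (hz α hα)]
  · rwa [tsum_eq_sum (s := Finset.range N) (fun a ha => by rw [hz α hα a ha, mul_zero])] at h2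

theorem aux_bound (δ : ℕ → ℝ) (h : (Function.support δ).Finite) :
    ∃ N : ℕ, ∀ a, N ≤ a → δ a = 0 := by
  obtain ⟨M, hM⟩ := h.bddAbove
  refine ⟨M + 1, fun a ha => ?_⟩
  by_contra hne
  have := hM (show a ∈ Function.support δ from hne)
  omega

/-- Convex combinations preserve `⪯_γ` domination. -/
theorem stmt3 (n H : ℕ) (γ : ℝ) (hγ : 0 < γ)
    (δ δ' : Fin H → ℕ → ℝ)
    (hδ : ∀ h, memS n (δ h)) (hδ' : ∀ h, memS n (δ' h))
    (hdom : ∀ h, Dominates n γ (δ' h) (δ h))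
    (β : Fin H → ℝ) (hβ0 : ∀ h, 0 ≤ β h) (hβ1 : ∀ h, β h ≤ 1)
    (hβsum : (∑ h, β h) = 1) :
    Dominates n γ (fun a => ∑ h, β h * δ' h a) (fun a => ∑ h, β h * δ h a) := by
  intro l hl0 hln
  choose N1 hN1 using fun h => aux_bound (δ h) (hδ h).2.1
  choose N2 hN2 using fun h => aux_bound (δ' h) (hδ' h).2.1
  obtain ⟨N, hN, hN'⟩ : ∃ N : ℕ, (∀ h a, N ≤ a → δ h a = 0) ∧ (∀ h a, N ≤ a → δ' h a = 0) := by
    refine ⟨∑ h, (N1 h + N2 h), fun h a ha => hN1 h a ?_, fun h a ha => hN2 h a ?_⟩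
    all_goals
      have := Finset.single_le_sum (f := fun h => N1 h + N2 h) (fun i _ => Nat.zero_le _)
        (Finset.mem_univ h)
      omega
  have hs : ∀ h, ∑ a ∈ Finset.range N, δ h a = n := fun h => by
    rw [← (hδ h).2.2, tsum_eq_sum]
    intro a ha
    exact hN h a (by simpa using ha)
  have hs' : ∀ h, ∑ a ∈ Finset.range N, δ' h a = n := fun h => by
    rw [← (hδ' h).2.2, tsum_eq_sum]
    intro a ha
    exact hN' h a (by simpa using ha)
  -- exchange of summation
  have hex : ∀ (w : ℕ → ℝ) (f : Fin H → ℕ → ℝ),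
      ∑ a ∈ Finset.range N, w a * ∑ h, β h * f h a
        = ∑ h, β h * ∑ a ∈ Finset.range N, w a * f h a := by
    intro w f
    simp only [Finset.mul_sum]
    rw [Finset.sum_comm]
    refine Finset.sum_congr rfl fun h _ => Finset.sum_congr rfl fun a _ => by ring
  have hex1 : ∀ (f : Fin H → ℕ → ℝ),
      ∑ a ∈ Finset.range N, ∑ h, β h * f h a
        = ∑ h, β h * ∑ a ∈ Finset.range N, f h a := by
    intro f
    simpa using hex (fun _ => 1) f
  apply Real.sSup_le
  swap
  · apply mul_nonneg hγ.le
    apply Real.sSup_nonneg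
    rintro s ⟨α, hα, -, rfl⟩
    exact tsum_nonneg fun a => mul_nonneg (Nat.cast_nonneg a) (hα a).1
  rintro s ⟨α, hα, hαl, rfl⟩
  have hz : ∀ a, a ∉ Finset.range N → α a = 0 := by
    intro a ha
    have h1 := hα a
    have h2 : ∑ h, β h * δ' h a = 0 :=
      Finset.sum_eq_zero fun h _ => by rw [hN' h a (by simpa using ha), mul_zero]
    simp only [h2] at h1
    linarith
  rw [tsum_eq_sum hz] at hαl
  rw [tsum_eq_sum (s := Finset.range N) (fun a ha => by rw [hz a ha, mul_zero])]
  set D : ℕ → ℝ := fun a => ∑ h, β h * δ' h a with hD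
  have hD0 : ∀ a, 0 ≤ D a := fun a => le_trans (hα a).1 (hα a).2
  set A : Fin H → ℕ → ℝ := fun h a => α a / D a * δ' h a with hA
  have hAb : ∀ h a, 0 ≤ A h a ∧ A h a ≤ δ' h a := by
    intro h a
    have h1 : 0 ≤ α a / D a := div_nonneg (hα a).1 (hD0 a)
    have h2 : α a / D a ≤ 1 := div_le_one_of_le₀ (hα a).2 (hD0 a)
    exact ⟨mul_nonneg h1 ((hδ' h).1 a), mul_le_of_le_one_left ((hδ' h).1 a) h2⟩
  have hAα : ∀ a, α a = ∑ h, β h * A h a := by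
    intro a
    have h1 : ∑ h, β h * A h a = α a / D a * D a := by
      simp only [hA, hD, Finset.mul_sum]
      refine Finset.sum_congr rfl fun h _ => by ring
    rw [h1]
    rcases eq_or_ne (D a) 0 with h | h
    · have h2 := hα a
      have h3 : α a ≤ D a := h2.2
      rw [h] at h3 ⊢
      simp
      linarith [h2.1]
    · field_simp
  set L : Fin H → ℝ := fun h => ∑ a ∈ Finset.range N, A h a with hL
  have hL0 : ∀ h, 0 ≤ L h := fun h => Finset.sum_nonneg fun a _ => (hAb h a).1
  have hLn : ∀ h, L h ≤ n := fun h => by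
    rw [← hs' h]
    exact Finset.sum_le_sum fun a _ => (hAb h a).2
  have hLl : ∑ h, β h * L h = l := by
    rw [← hαl, Finset.sum_congr rfl (fun a _ => hAα a), hex1]
  have hval : ∑ a ∈ Finset.range N, (a : ℝ) * α a
      = ∑ h, β h * ∑ a ∈ Finset.range N, (a : ℝ) * A h a := by
    rw [← hex, Finset.sum_congr rfl (fun a _ => by rw [hAα a])]
  have step1 : ∑ a ∈ Finset.range N, (a : ℝ) * α a ≤ γ * ∑ h, β h * topBar (δ h) (L h) := by
    rw [hval, Finset.mul_sum]
    refine Finset.sum_le_sum fun h _ => ?_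
    have h1 := aux_le_topBar N (δ' h) (hN' h) (A h) (hAb h)
    have h2 := hdom h (L h) (hL0 h) (hLn h)
    calc _ ≤ β h * (γ * topBar (δ h) (L h)) := mul_le_mul_of_nonneg_left (h1.trans h2) (hβ0 h)
      _ = _ := by ring
  refine step1.trans (mul_le_mul_of_nonneg_left ?_ hγ.le)
  refine le_of_forall_pos_le_add fun ε hε => ?_
  choose B hB hBL hBv using fun h => aux_near n N (δ h) (hN h) (hδ h).1 (hs h) (L h) (hL0 h)
    (hLn h) ε hε
  have h1 := aux_le_topBar N (fun a => ∑ h, β h * δ h a)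
    (fun a ha => Finset.sum_eq_zero fun h _ => by rw [hN h a ha, mul_zero])
    (fun a => ∑ h, β h * B h a)
    (fun a => ⟨Finset.sum_nonneg fun h _ => mul_nonneg (hβ0 h) (hB h a).1,
      Finset.sum_le_sum fun h _ => mul_le_mul_of_nonneg_left (hB h a).2 (hβ0 h)⟩)
  rw [hex, hex1] at h1
  simp only [hBL] at h1
  rw [hLl] at h1
  have h2 : ∑ h, β h * topBar (δ h) (L h)
      ≤ ∑ h, β h * (∑ a ∈ Finset.range N, (a : ℝ) * B h a) + ∑ h, β h * ε := by
    rw [← Finset.sum_add_distrib]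
    refine Finset.sum_le_sum fun h _ => ?_
    rw [← mul_add]
    exact mul_le_mul_of_nonneg_left (by linarith [hBv h]) (hβ0 h)
  rw [← Finset.sum_mul, hβsum, one_mul] at h2
  linarith
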